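/- For every integer n ≥ 0, the function f_n(τ) = π^{2n}·x(τ)^n·p_n(u(τ)) is a modular form of weight 2n for Γ(2); in particular, for every matrix (a b; c d) ∈ Γ(2) and every τ ∈ ℍ one has f_n((aτ+b)/(cτ+d)) = (cτ+d)^{2n}·f_n(τ). -/

import Mathlib

open Polynomial Complex

noncomputable section

/-- `θ₂(τ) = ∑_{n ∈ ℤ} exp(πi(n+1/2)²τ)`. -/
def theta2 (τ : ℂ) : ℂ := ∑' n : ℤ, Complex.exp (Real.pi * Complex.I * ((n : ℂ) + 1/2) ^ 2 * τ)

/-- `θ₄(τ) = ∑_{n ∈ ℤ} (-1)ⁿ exp(πin²τ)`. -/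
def theta4 (τ : ℂ) : ℂ :=
  ∑' n : ℤ, (-1 : ℂ) ^ n * Complex.exp (Real.pi * Complex.I * (n : ℂ) ^ 2 * τ)

/-- `x(τ) = -θ₄(τ)⁴`. -/
def xx (τ : ℂ) : ℂ := -(theta4 τ) ^ 4

/-- `y(τ) = θ₂(τ)⁴`. -/
def yy (τ : ℂ) : ℂ := (theta2 τ) ^ 4

/-- The Hauptmodul `u(τ) = y(τ)/x(τ)`. -/
def uu (τ : ℂ) : ℂ := yy τ / xx τ


open UpperHalfPlane hiding I
open ModularForm
open scoped Matrix
open scoped MatrixGroups Manifold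

namespace FnAux

/-! ### Theta constants -/

lemma theta2_eq (τ : ℂ) :
    theta2 τ = cexp (Real.pi * I * τ / 4) * jacobiTheta₂ (τ / 2) τ := by
  unfold theta2 jacobiTheta₂ jacobiTheta₂_term
  rw [← tsum_mul_left]
  refine tsum_congr fun n => ?_
  rw [← Complex.exp_add]
  congr 1
  ring

lemma exp_pi_int (n : ℤ) : cexp (Real.pi * I * n) = (-1 : ℂ) ^ n := by
  rw [mul_comm, Complex.exp_int_mul, Complex.exp_pi_mul_I]

lemma theta4_eq (τ : ℂ) : theta4 τ = jacobiTheta₂ (1 / 2) τ := by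
  unfold theta4 jacobiTheta₂ jacobiTheta₂_term
  refine tsum_congr fun n => ?_
  rw [← exp_pi_int, ← Complex.exp_add]
  congr 1
  ring

lemma neg_one_zpow_sq (n : ℤ) : (-1 : ℂ) ^ (n ^ 2) = (-1 : ℂ) ^ n := by
  rcases Int.even_or_odd n with h | h
  · rw [h.neg_one_zpow, Even.neg_one_zpow (by simpa [Int.even_pow] using h)]
  · rw [h.neg_one_zpow, Odd.neg_one_zpow (h.pow)]

lemma jacobiTheta_add_one (τ : ℂ) : jacobiTheta (τ + 1) = theta4 τ := by
  unfold theta4 jacobiTheta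
  refine tsum_congr fun n => ?_
  rw [← neg_one_zpow_sq, ← exp_pi_int, ← Complex.exp_add]
  congr 1
  push_cast
  ring

lemma theta4_add_one (τ : ℂ) : theta4 (τ + 1) = jacobiTheta τ := by
  rw [← jacobiTheta_add_one, add_assoc, one_add_one_eq_two, add_comm, jacobiTheta_two_add]

lemma theta2_add_one (τ : ℂ) : theta2 (τ + 1) = cexp (Real.pi * I / 4) * theta2 τ := by
  unfold theta2
  rw [← tsum_mul_left]
  refine tsum_congr fun n => ?_
  have h : cexp (Real.pi * I * ((n ^ 2 + n : ℤ) : ℂ)) = 1 := by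
    rw [exp_pi_int]
    apply Even.neg_one_zpow
    have := Int.even_mul_succ_self n
    rwa [show n ^ 2 + n = n * (n + 1) by ring]
  have e : (Real.pi * I * ((n : ℂ) + 1/2) ^ 2 * (τ + 1)) = Real.pi * I / 4 +
      Real.pi * I * ((n : ℂ) + 1/2) ^ 2 * τ + Real.pi * I * ((n ^ 2 + n : ℤ) : ℂ) := by
    push_cast
    ring
  rw [e, Complex.exp_add, h, mul_one, Complex.exp_add]

lemma theta2_pow_add_one (τ : ℂ) : theta2 (τ + 1) ^ 4 = - theta2 τ ^ 4 := by
  rw [theta2_add_one, mul_pow, ← Complex.exp_nat_mul]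
  rw [show ((4 : ℕ) : ℂ) * (Real.pi * I / 4) = Real.pi * I by push_cast; ring,
    Complex.exp_pi_mul_I]
  ring

lemma sqrt_pow {τ : ℂ} : ((-I * τ) ^ (1 / 2 : ℂ)) ^ 4 = - τ ^ 2 := by
  have : ((-I * τ) ^ (1 / 2 : ℂ)) ^ 2 = -I * τ := by
    rw [one_div]
    exact Complex.cpow_nat_inv_pow _ (by norm_num)
  rw [show 4 = 2 * 2 from rfl, pow_mul, this, mul_pow, neg_sq, I_sq]
  ring

lemma theta2_S {τ : ℂ} (h : τ ≠ 0) : theta2 (-1 / τ) ^ 4 = - τ ^ 2 * theta4 τ ^ 4 := by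
  have h1 : (-I * τ) ^ (1 / 2 : ℂ) ≠ 0 := by
    rw [Ne, cpow_eq_zero_iff, not_and_or]
    exact Or.inl <| mul_ne_zero (neg_ne_zero.mpr I_ne_zero) h
  have key : theta4 τ = 1 / (-I * τ) ^ (1 / 2 : ℂ) * theta2 (-1 / τ) := by
    rw [theta4_eq, jacobiTheta₂_functional_equation, theta2_eq, ← jacobiTheta₂_neg_left, mul_assoc]
    congr 2
    · congr 1
      field_simp
      norm_num
    · congr 1
      field_simp
  rw [← sqrt_pow, ← mul_pow, key]
  congr 1
  field_simp

lemma theta4_S {τ : ℂ} (h : τ ≠ 0) : theta4 (-1 / τ) ^ 4 = - τ ^ 2 * theta2 τ ^ 4 := by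
  have := theta2_S (τ := -1 / τ) (div_ne_zero (by norm_num) h)
  rw [show -1 / (-1 / τ) = τ by field_simp] at this
  rw [this]
  field_simp

lemma jacobiTheta_S {τ : ℂ} (h : 0 < τ.im) :
    jacobiTheta (-1 / τ) ^ 4 = - τ ^ 2 * jacobiTheta τ ^ 4 := by
  have := jacobiTheta_S_smul ⟨τ, h⟩
  rw [UpperHalfPlane.modular_S_smul] at this
  simp only [UpperHalfPlane.coe_mk] at this
  rw [show (-1 / τ) = (-τ)⁻¹ by rw [inv_neg, neg_div, one_div], this, mul_pow, sqrt_pow]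

/-! ### Boundedness -/

lemma bdd_jacobiTheta : IsBoundedAtImInfty (fun τ : ℍ => jacobiTheta τ) := by
  rw [UpperHalfPlane.isBoundedAtImInfty_iff]
  refine ⟨1 + 2 / (1 - Real.exp (-Real.pi)), 1, fun z hz => ?_⟩
  have hz' : (1 : ℝ) ≤ (z : ℂ).im := hz
  have h := norm_jacobiTheta_sub_one_le (τ := (z : ℂ)) z.2
  have h3 : Real.exp (-Real.pi * (z : ℂ).im) ≤ Real.exp (-Real.pi) := by
    apply Real.exp_le_exp.mpr
    nlinarith [Real.pi_pos]
  have h4 : Real.exp (-Real.pi) < 1 := by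
    rw [Real.exp_lt_one_iff]; linarith [Real.pi_pos]
  have h5 : 2 / (1 - Real.exp (-Real.pi * (z : ℂ).im)) * Real.exp (-Real.pi * (z : ℂ).im)
      ≤ 2 / (1 - Real.exp (-Real.pi)) * 1 := by
    gcongr
    · linarith
  calc ‖jacobiTheta z‖ = ‖1 + (jacobiTheta z - 1)‖ := by congr 1; ring
    _ ≤ ‖(1 : ℂ)‖ + ‖jacobiTheta z - 1‖ := norm_add_le _ _
    _ ≤ _ := by rw [norm_one]; linarith

lemma bdd_theta4 : IsBoundedAtImInfty (fun τ : ℍ => theta4 τ) := by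
  obtain ⟨M, A, h⟩ := UpperHalfPlane.isBoundedAtImInfty_iff.mp bdd_jacobiTheta
  rw [UpperHalfPlane.isBoundedAtImInfty_iff]
  refine ⟨M, A, fun z hz => ?_⟩
  have := h ((1 : ℝ) +ᵥ z) (by simpa using hz)
  rw [← jacobiTheta_add_one]
  simpa [add_comm] using this

lemma norm_theta2_term (n : ℤ) (τ : ℂ) :
    ‖cexp (Real.pi * I * ((n : ℂ) + 1/2) ^ 2 * τ)‖
      = Real.exp (-(Real.pi * ((n : ℝ) + 1 / 2) ^ 2 * τ.im)) := by
  rw [Complex.norm_exp]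
  congr 1
  rw [show (Real.pi * I * ((n : ℂ) + 1/2) ^ 2 * τ)
    = ((Real.pi * ((n : ℝ) + 1 / 2) ^ 2 : ℝ) : ℂ) * (τ * I) by push_cast; ring]
  rw [re_ofReal_mul, mul_I_re]
  ring

lemma summable_theta2 {τ : ℂ} (h : 0 < τ.im) :
    Summable fun n : ℤ => cexp (Real.pi * I * ((n : ℂ) + 1/2) ^ 2 * τ) := by
  have := ((summable_jacobiTheta₂_term_iff (τ / 2) τ).mpr h).mul_left (cexp (Real.pi * I * τ / 4))
  refine this.congr fun n => ?_
  unfold jacobiTheta₂_term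
  rw [← Complex.exp_add]
  congr 1
  ring

lemma bdd_theta2 : IsBoundedAtImInfty (fun τ : ℍ => theta2 τ) := by
  rw [UpperHalfPlane.isBoundedAtImInfty_iff]
  refine ⟨∑' n : ℤ, ‖cexp (Real.pi * I * ((n : ℂ) + 1/2) ^ 2 * I)‖, 1, fun z hz => ?_⟩
  have hz' : (1 : ℝ) ≤ (z : ℂ).im := hz
  have s1 := (summable_theta2 (τ := (z : ℂ)) z.2).norm
  have s2 := (summable_theta2 (τ := I) (by simp)).norm
  refine (norm_tsum_le_tsum_norm s1).trans (s1.tsum_mono s2 fun n => ?_)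
  simp only [norm_theta2_term, Complex.I_im]
  apply Real.exp_le_exp.mpr
  have : 0 ≤ Real.pi * ((n : ℝ) + 1 / 2) ^ 2 := by positivity
  nlinarith

/-! ### Holomorphy -/

lemma diff_theta4 {τ : ℂ} (h : 0 < τ.im) : DifferentiableAt ℂ theta4 τ := by
  rw [funext theta4_eq]
  exact differentiableAt_jacobiTheta₂_snd _ h

lemma diff_theta2 {τ : ℂ} (h : 0 < τ.im) : DifferentiableAt ℂ theta2 τ := by
  rw [funext theta2_eq]
  have h1 : DifferentiableAt ℂ (fun t : ℂ => jacobiTheta₂ (t / 2) t) τ :=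
    DifferentiableAt.comp (f := fun t : ℂ => (t / 2, t))
      (g := fun p : ℂ × ℂ => jacobiTheta₂ p.1 p.2) τ
      (hasFDerivAt_jacobiTheta₂ (τ / 2) h).differentiableAt (by fun_prop)
  exact DifferentiableAt.mul (by fun_prop) h1

/-! ### The triple of fourth powers -/

/-- The triple `(θ₂⁴, -θ₃⁴, θ₄⁴)` on the upper half-plane. -/
def v : Fin 3 → ℍ → ℂ :=
  ![fun τ => theta2 τ ^ 4, fun τ => - jacobiTheta τ ^ 4, fun τ => theta4 τ ^ 4]

/-- The nonzero row vectors over the field with two elements, in the matching order. -/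
def w : Fin 3 → Fin 2 → ZMod 2 := ![![0, 1], ![1, 1], ![1, 0]]

lemma w_inj : Function.Injective w := by decide

/-- Reduction mod 2. -/
def red : SL(2, ℤ) →* SL(2, ZMod 2) := Matrix.SpecialLinearGroup.map (Int.castRingHom (ZMod 2))

lemma v_bdd (i : Fin 3) : IsBoundedAtImInfty (v i) := by
  have pw : ∀ g : ℍ → ℂ, IsBoundedAtImInfty g → IsBoundedAtImInfty (fun τ => g τ ^ 4) := by
    intro g hg
    have := Asymptotics.IsBigO.pow hg 4
    simpa only [Pi.one_apply, one_pow] using! this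
  fin_cases i
  · exact pw _ bdd_theta2
  · exact Asymptotics.IsBigO.neg_left (pw _ bdd_jacobiTheta)
  · exact pw _ bdd_theta4

/-- The compatibility of the slash action with a permutation. -/
def Good (g : SL(2, ℤ)) : Prop := ∃ σ : Equiv.Perm (Fin 3),
  (∀ i, v i ∣[(2 : ℤ)] g = ((Equiv.Perm.sign σ : ℤ) : ℂ) • v (σ i)) ∧
  (∀ i, w i ᵥ* (red g).1 = w (σ i))

lemma good_S : Good ModularGroup.S := by
  refine ⟨Equiv.swap 0 2, fun i => ?_, by decide⟩
  have hs : Equiv.Perm.sign (Equiv.swap (0 : Fin 3) 2) = -1 := by decide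
  rw [hs]
  ext τ
  have h0 : (τ : ℂ) ≠ 0 := τ.ne_zero
  rw [SL_slash_apply, UpperHalfPlane.modular_S_smul, ModularGroup.denom_S]
  have e : (-(τ : ℂ))⁻¹ = -1 / τ := by rw [inv_neg, neg_div, one_div]
  fin_cases i
  · simp [v, e, theta2_S h0, zpow_ofNat, Equiv.swap_apply_def]
    field_simp
  · simp [v, e, jacobiTheta_S τ.2, zpow_ofNat, Equiv.swap_apply_def]
    field_simp
  · simp [v, e, theta4_S h0, zpow_ofNat, Equiv.swap_apply_def]
    field_simp

lemma good_T : Good ModularGroup.T := by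
  refine ⟨Equiv.swap 1 2, fun i => ?_, by decide⟩
  have hs : Equiv.Perm.sign (Equiv.swap (1 : Fin 3) 2) = -1 := by decide
  rw [hs]
  ext τ
  rw [SL_slash_apply, UpperHalfPlane.modular_T_smul]
  have hd : denom ModularGroup.T τ = 1 := by
    rw [ModularGroup.denom_apply]
    simp [ModularGroup.T]
  rw [hd]
  fin_cases i
  · simp [v, add_comm (1 : ℂ), theta2_pow_add_one, Equiv.swap_apply_def]
  · simp [v, add_comm (1 : ℂ), jacobiTheta_add_one, Equiv.swap_apply_def]
  · simp [v, add_comm (1 : ℂ), theta4_add_one, Equiv.swap_apply_def]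

lemma good_one : Good 1 := ⟨1, by simp, by simp⟩

lemma good_mul {g h : SL(2, ℤ)} (hg : Good g) (hh : Good h) : Good (g * h) := by
  obtain ⟨σ, h1, h2⟩ := hg
  obtain ⟨ρ, h3, h4⟩ := hh
  refine ⟨ρ * σ, fun i => ?_, fun i => ?_⟩
  · rw [SlashAction.slash_mul, h1, SL_smul_slash, h3, smul_smul]
    simp [mul_comm]
  · rw [map_mul, Matrix.SpecialLinearGroup.coe_mul, ← Matrix.vecMul_vecMul, h2, h4]
    rfl

lemma good_inv {g : SL(2, ℤ)} (hg : Good g) : Good g⁻¹ := by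
  obtain ⟨σ, h1, h2⟩ := hg
  refine ⟨σ⁻¹, fun i => ?_, fun i => ?_⟩
  · obtain ⟨j, rfl⟩ := σ.surjective i
    have := congrArg (fun F => F ∣[(2 : ℤ)] g⁻¹) (h1 j)
    simp only [← SlashAction.slash_mul, mul_inv_cancel, SlashAction.slash_one,
      SL_smul_slash] at this
    have hs : ((Equiv.Perm.sign σ : ℤ) : ℂ) * ((Equiv.Perm.sign σ : ℤ) : ℂ) = 1 := by
      rcases Int.units_eq_one_or (Equiv.Perm.sign σ) with h | h <;> simp [h]
    simp [this, smul_smul, hs]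
  · obtain ⟨j, rfl⟩ := σ.surjective i
    rw [← h2, Matrix.vecMul_vecMul, ← Matrix.SpecialLinearGroup.coe_mul, ← map_mul]
    simp

lemma good_all (g : SL(2, ℤ)) : Good g := by
  have : g ∈ Subgroup.closure {ModularGroup.S, ModularGroup.T} := by
    simp [SpecialLinearGroup.SL2Z_generators]
  induction this using Subgroup.closure_induction with
  | mem x hx =>
    rcases hx with rfl | rfl
    · exact good_S
    · exact good_T
  | one => exact good_one
  | mul x y _ _ hx hy => exact good_mul hx hy
  | inv x _ hx => exact good_inv hx

lemma v_Gamma {g : SL(2, ℤ)} (hg : g ∈ CongruenceSubgroup.Gamma 2) (i : Fin 3) :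
    v i ∣[(2 : ℤ)] g = v i := by
  obtain ⟨σ, h1, h2⟩ := good_all g
  have hr : red g = 1 := (CongruenceSubgroup.Gamma_mem' (N := 2)).mp hg
  have : σ = 1 := by
    ext1 i
    apply w_inj
    rw [← h2, hr]
    simp
  rw [h1, this]
  simp

/-! ### Degrees -/

lemma coeff_zero (p : ℕ → Polynomial ℚ) (hp0 : p 0 = 1)
    (hprec : ∀ n : ℕ,
      (((n : ℚ) + 1) ^ 2) • p (n + 1) + (X ^ 2 - X) * Polynomial.derivative (p n)
        - (n : ℚ) • (X * p n)
        + (1/4 : ℚ) • (X * (if n = 0 then 0 else p (n - 1))) = 0) :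
    ∀ n k : ℕ, 1 ≤ n → n ≤ k → (p n).coeff k = 0 := by
  intro n
  induction n using Nat.strong_induction_on with
  | _ n ih =>
    intro k hn hk
    obtain ⟨m, rfl⟩ : ∃ m, n = m + 1 := ⟨n - 1, by omega⟩
    obtain ⟨j, rfl⟩ : ∃ j, k = j + 1 := ⟨k - 1, by omega⟩
    have h := congrArg (fun q => q.coeff (j + 1)) (hprec m)
    rcases Nat.eq_zero_or_pos m with rfl | hm
    · simpa [hp0] using h
    · obtain ⟨i, rfl⟩ : ∃ i, j = i + 1 := ⟨j - 1, by omega⟩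
      have c1 : (p m).coeff (i + 1) = 0 := ih m (by omega) _ hm (by omega)
      have c2 : (p m).coeff (i + 1 + 1) = 0 := ih m (by omega) _ hm (by omega)
      have c3 : (p (m - 1)).coeff (i + 1) = 0 := by
        rcases Nat.eq_zero_or_pos (m - 1) with h0 | h0
        · rw [h0, hp0, Polynomial.coeff_one]; simp
        · exact ih _ (by omega) _ h0 (by omega)
      have hm' : m ≠ 0 := by omega
      simp only [hm', if_false, sub_mul, pow_two, mul_assoc, Polynomial.coeff_add,
        Polynomial.coeff_sub, Polynomial.coeff_smul, Polynomial.coeff_X_mul,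
        Polynomial.coeff_derivative, c1, c2, c3, Polynomial.coeff_zero] at h
      simp only [smul_eq_mul, zero_mul, mul_zero, sub_zero, add_zero] at h
      have : ((m : ℚ) + 1) ≠ 0 := by positivity
      simpa [this] using h

/-- The homogenized polynomial. -/
def H (n : ℕ) (q : Polynomial ℚ) (x y : ℂ) : ℂ :=
  (Real.pi : ℂ) ^ (2 * n) * ∑ k ∈ Finset.range (n + 1), (q.coeff k : ℂ) * (y ^ k * x ^ (n - k))

lemma H_smul (n : ℕ) (q : Polynomial ℚ) (s x y : ℂ) :
    H n q (s * x) (s * y) = s ^ n * H n q x y := by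
  unfold H
  rw [mul_left_comm, Finset.mul_sum _ _ (s ^ n)]
  congr 1
  refine Finset.sum_congr rfl fun k hk => ?_
  have : k ≤ n := by simpa [Nat.lt_succ_iff] using hk
  obtain ⟨j, rfl⟩ := Nat.exists_eq_add_of_le this
  simp only [Nat.add_sub_cancel_left]
  ring

lemma eq_H (n : ℕ) (q : Polynomial ℚ) (hq : ∀ k, n < k → q.coeff k = 0)
    (hq' : 1 ≤ n → q.coeff n = 0) (x y : ℂ) :
    (Real.pi : ℂ) ^ (2 * n) * x ^ n * Polynomial.aeval (y / x) q = H n q x y := by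
  unfold H
  rw [mul_assoc]
  congr 1
  rw [Polynomial.aeval_eq_sum_range' (n := n + 1), Finset.mul_sum]
  · refine Finset.sum_congr rfl fun k hk => ?_
    have hk : k ≤ n := by simpa [Nat.lt_succ_iff] using hk
    rw [Algebra.smul_def]
    change x ^ n * ((q.coeff k : ℂ) * _) = _
    rcases Nat.eq_zero_or_pos n with rfl | hn
    · obtain rfl : k = 0 := by omega
      simp
    · rcases hk.eq_or_lt with rfl | hlt
      · simp [hq' hn]
      · obtain ⟨j, rfl⟩ := Nat.exists_eq_add_of_lt hlt
        rw [show k + j + 1 - k = j + 1 by omega]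
        by_cases hx : x = 0
        · simp [hx]
        · rw [div_pow]
          field_simp
          ring
  · exact Nat.lt_succ_of_le (Polynomial.natDegree_le_iff_coeff_eq_zero.mpr hq)

lemma H_bdd (n : ℕ) (q : Polynomial ℚ) (x y : ℍ → ℂ) (hx : IsBoundedAtImInfty x)
    (hy : IsBoundedAtImInfty y) : IsBoundedAtImInfty (fun τ => H n q (x τ) (y τ)) := by
  unfold H
  refine Asymptotics.IsBigO.const_mul_left (Asymptotics.IsBigO.fun_sum fun k _ => ?_) _
  refine Asymptotics.IsBigO.const_mul_left ?_ _
  have := (Asymptotics.IsBigO.pow hy k).mul (Asymptotics.IsBigO.pow hx (n - k))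
  simpa [Pi.one_def] using this

/-- The modular form as a function on the upper half-plane. -/
def F (n : ℕ) (q : Polynomial ℚ) (τ : ℍ) : ℂ := H n q (- v 2 τ) (v 0 τ)

lemma F_slash (n : ℕ) (q : Polynomial ℚ) (g : SL(2, ℤ)) (τ : ℍ) :
    (F n q ∣[(2 * n : ℤ)] g) τ
      = H n q (-(v 2 ∣[(2 : ℤ)] g) τ) ((v 0 ∣[(2 : ℤ)] g) τ) := by
  simp only [SL_slash_apply, F]
  rw [show -(v 2 (g • τ) * denom g τ ^ (-2 : ℤ)) = denom g τ ^ (-2 : ℤ) * (- v 2 (g • τ)) by ring,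
    mul_comm (v 0 (g • τ)), H_smul, mul_comm, ← zpow_natCast, ← _root_.zpow_mul, neg_mul]

lemma F_Gamma (n : ℕ) (q : Polynomial ℚ) {g : SL(2, ℤ)} (hg : g ∈ CongruenceSubgroup.Gamma 2) :
    F n q ∣[(2 * n : ℤ)] g = F n q := by
  ext τ
  rw [F_slash, v_Gamma hg, v_Gamma hg]
  rfl

lemma F_bdd (n : ℕ) (q : Polynomial ℚ) (g : SL(2, ℤ)) :
    IsBoundedAtImInfty (F n q ∣[(2 * n : ℤ)] g) := by
  obtain ⟨σ, h1, -⟩ := good_all g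
  have : F n q ∣[(2 * n : ℤ)] g = fun τ => H n q (-(v 2 ∣[(2 : ℤ)] g) τ) ((v 0 ∣[(2 : ℤ)] g) τ) :=
    funext fun τ => F_slash n q g τ
  rw [this]
  apply H_bdd
  · rw [h1]
    exact Asymptotics.IsBigO.neg_left (Asymptotics.IsBigO.const_mul_left (v_bdd _) _)
  · rw [h1]
    exact Asymptotics.IsBigO.const_mul_left (v_bdd _) _

lemma F_mdiff (n : ℕ) (q : Polynomial ℚ) : MDiff (F n q) := by
  rw [UpperHalfPlane.mdifferentiable_iff]
  have : DifferentiableOn ℂ (fun τ : ℂ => H n q (-(theta4 τ) ^ 4) (theta2 τ ^ 4))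
      {z | 0 < z.im} := by
    intro z hz
    have h2 := diff_theta2 hz
    have h4 := diff_theta4 hz
    apply DifferentiableAt.differentiableWithinAt
    unfold H
    fun_prop
  refine this.congr fun z hz => ?_
  simp [F, v, Function.comp, ofComplex_apply_of_im_pos hz]

end FnAux

/-- For every `n ≥ 0`, the function `f_n(τ) = π^{2n} x(τ)ⁿ pₙ(u(τ))` is a modular form of
weight `2n` for `Γ(2)`; in particular it satisfies the weight-`2n` transformation law under
every matrix of `Γ(2)`. -/
theorem fn_is_modular_form
    (p : ℕ → Polynomial ℚ)
    (hp0 : p 0 = 1)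
    (hprec : ∀ n : ℕ,
      (((n : ℚ) + 1) ^ 2) • p (n + 1) + (X ^ 2 - X) * Polynomial.derivative (p n)
        - (n : ℚ) • (X * p n)
        + (1/4 : ℚ) • (X * (if n = 0 then 0 else p (n - 1))) = 0)
    (n : ℕ)
    (f : ℂ → ℂ)
    (hf : ∀ τ : ℂ, f τ = (Real.pi : ℂ) ^ (2 * n) * (xx τ) ^ n * Polynomial.aeval (uu τ) (p n)) :
    (∃ g : ModularForm (CongruenceSubgroup.Gamma 2) (2 * n : ℤ),
      ∀ τ : UpperHalfPlane, g τ = f (τ : ℂ)) ∧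
    (∀ a b c d : ℤ, a * d - b * c = 1 →
      a % 2 = 1 % 2 → d % 2 = 1 % 2 → b % 2 = 0 → c % 2 = 0 →
      ∀ τ : ℂ, 0 < τ.im →
        f (((a : ℂ) * τ + b) / ((c : ℂ) * τ + d)) = ((c : ℂ) * τ + d) ^ (2 * n) * f τ) := by
  have hc := FnAux.coeff_zero p hp0 hprec
  have hfF : ∀ τ : ℍ, f (τ : ℂ) = FnAux.F n (p n) τ := by
    intro τ
    rw [hf]
    unfold uu
    rw [FnAux.eq_H]
    · rfl
    · intro k hk
      rcases Nat.eq_zero_or_pos n with rfl | hn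
      · rw [hp0, Polynomial.coeff_one, if_neg (by omega)]
      · exact hc n k hn hk.le
    · exact fun hn => hc n n hn le_rfl
  refine ⟨⟨{ toFun := FnAux.F n (p n), slash_action_eq' := ?_, holo' := FnAux.F_mdiff n (p n),
             bdd_at_cusps' := ?_ }, fun τ => (hfF τ).symm⟩, ?_⟩
  · rintro _ ⟨γ, hγ, rfl⟩
    exact FnAux.F_Gamma n (p n) hγ
  · intro c hcusp
    rw [Subgroup.IsArithmetic.isCusp_iff_isCusp_SL2Z] at hcusp
    rw [OnePoint.isBoundedAt_iff_forall_SL2Z hcusp]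
    exact fun γ _ => FnAux.F_bdd n (p n) γ
  · intro a b c d hdet ha hd hb hcc τ hτ
    let g : SL(2, ℤ) := ⟨!![a, b; c, d], by rw [Matrix.det_fin_two_of]; exact hdet⟩
    have hg : g ∈ CongruenceSubgroup.Gamma 2 := by
      rw [CongruenceSubgroup.Gamma_mem]
      have e1 : ∀ m : ℤ, m % 2 = 1 % 2 → (m : ZMod 2) = 1 := fun m hm => by
        exact_mod_cast (ZMod.intCast_eq_intCast_iff m 1 2).mpr hm
      have e0 : ∀ m : ℤ, m % 2 = 0 → (m : ZMod 2) = 0 := fun m hm => by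
        exact_mod_cast (ZMod.intCast_eq_intCast_iff m 0 2).mpr (by simpa [Int.ModEq] using hm)
      exact ⟨e1 a ha, e0 b hb, e0 c hcc, e1 d hd⟩
    have h := congrFun (FnAux.F_Gamma n (p n) hg) ⟨τ, hτ⟩
    rw [SL_slash_apply, ← hfF, ← hfF, coe_specialLinearGroup_apply] at h
    have hden : denom g ((⟨τ, hτ⟩ : ℍ) : ℂ) = (c : ℂ) * τ + d := by
      rw [ModularGroup.denom_apply]
      simp [g]
    have hne : denom g ((⟨τ, hτ⟩ : ℍ) : ℂ) ≠ 0 := denom_ne_zero _ _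
    rw [hden] at h hne
    have hz : ((c : ℂ) * τ + d) ^ (-(2 * n : ℤ)) = (((c : ℂ) * τ + d) ^ (2 * n))⁻¹ := by
      rw [_root_.zpow_neg]
      norm_cast
    rw [hz, ← div_eq_mul_inv, div_eq_iff (pow_ne_zero _ hne)] at h
    rw [mul_comm _ (f τ)]
    simpa [g] using h
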